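/- arXiv:0905.3839 — 2 statements merged into one kernel-verified Lean document; each statement's English description precedes it below -/
import Mathlib

section
/- Fefferman–Stein type weak estimate for the Riesz potential: Let 0 < α < n and set q₀ = (n/α)′ = n/(n−α). Then there is a constant c = c(n,α) such that for every weight u on ℝⁿ and every measurable f, ‖I_α f‖_{L^{q₀,∞}(u)} ≤ c ∫_{ℝⁿ} |f(y)| (Mu(y))^{1/q₀} dy, where M is the Hardy–Littlewood maximal operator. -/
open MeasureTheory ENNReal Set

noncomputable section

/-- Euclidean space `ℝⁿ`. -/
abbrev Euc (n : ℕ) := EuclideanSpace ℝ (Fin n)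

variable {n : ℕ}

/-- The axis-parallel closed cube with lower corner `a` and side length `h`. -/
def Cube (a : Euc n) (h : ℝ) : Set (Euc n) :=
  {x | ∀ i, a i ≤ x i ∧ x i ≤ a i + h}

/-- The weighted measure `u(E) = ∫_E u dx` of a set. -/
def wMeas (u : Euc n → ℝ) (E : Set (Euc n)) : ℝ≥0∞ :=
  ∫⁻ x in E, ENNReal.ofReal (u x)

/-- The dual exponent `p' = p/(p-1)`. -/
def dualExp (p : ℝ) : ℝ := p / (p - 1)

/-- The `A_{p,q}` constant of a weight `w` (with the `A_{1,q}` convention when `p = 1`). -/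
def Apq (p q : ℝ) (w : Euc n → ℝ) : ℝ≥0∞ :=
  ⨆ (a : Euc n) (h : ℝ) (_ : 0 < h),
    ((volume (Cube a h))⁻¹ * ∫⁻ x in Cube a h, ENNReal.ofReal (w x) ^ q) *
      (if p = 1 then
        (essSup (fun x => (ENNReal.ofReal (w x))⁻¹) (volume.restrict (Cube a h))) ^ q
      else
        ((volume (Cube a h))⁻¹ * ∫⁻ x in Cube a h,
            ENNReal.ofReal (w x) ^ (-(dualExp p))) ^ (q / dualExp p))

/-- The weighted Lebesgue norm `‖w f‖_{L^p(ℝⁿ)}`. -/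
def wLp (w f : Euc n → ℝ) (p : ℝ) : ℝ≥0∞ :=
  (∫⁻ x, (ENNReal.ofReal (w x) * ENNReal.ofReal |f x|) ^ p) ^ (1 / p)

/-- The weighted Lebesgue norm `‖w g‖_{L^q(ℝⁿ)}` of an `ℝ≥0∞`-valued function. -/
def wLpE (w : Euc n → ℝ) (g : Euc n → ℝ≥0∞) (q : ℝ) : ℝ≥0∞ :=
  (∫⁻ x, (ENNReal.ofReal (w x) * g x) ^ q) ^ (1 / q)

/-- The weak norm `‖g‖_{L^{q,∞}(u)} = sup_{λ>0} λ u({|g|>λ})^{1/q}`. -/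
def weakLp (u : Euc n → ℝ) (g : Euc n → ℝ) (q : ℝ) : ℝ≥0∞ :=
  ⨆ (t : ℝ) (_ : 0 < t), ENNReal.ofReal t * wMeas u {x | t < |g x|} ^ (1 / q)

/-- The weak norm of an `ℝ≥0∞`-valued function. -/
def weakLpE (u : Euc n → ℝ) (g : Euc n → ℝ≥0∞) (q : ℝ) : ℝ≥0∞ :=
  ⨆ (t : ℝ) (_ : 0 < t), ENNReal.ofReal t * wMeas u {x | ENNReal.ofReal t < g x} ^ (1 / q)

/-- The fractional integral (Riesz potential) `I_α f(x) = ∫ |f(y)| |x-y|^{α-n} dy`. -/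
def riesz (α : ℝ) (f : Euc n → ℝ) (x : Euc n) : ℝ≥0∞ :=
  ∫⁻ y, ENNReal.ofReal |f y| * ENNReal.ofReal (‖x - y‖ ^ (α - (n : ℝ)))

/-- The fractional maximal operator `M_α f(x) = sup_{Q ∋ x} |Q|^{α/n-1} ∫_Q |f|`. -/
def fracMax (α : ℝ) (f : Euc n → ℝ) (x : Euc n) : ℝ≥0∞ :=
  ⨆ (a : Euc n) (h : ℝ) (_ : 0 < h) (_ : x ∈ Cube a h),
    volume (Cube a h) ^ (α / (n : ℝ) - 1) * ∫⁻ y in Cube a h, ENNReal.ofReal |f y|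


lemma vol_cube_aux (a : Euc n) (h : ℝ) : volume (Cube a h) = ENNReal.ofReal h ^ n := by
  have h1 : Cube a h = (MeasurableEquiv.toLp 2 (Fin n → ℝ)).symm ⁻¹'
      (Set.Icc (fun i => a i) (fun i => a i + h)) := by
    ext x
    simp only [Cube, Set.mem_ofPred_eq, Set.mem_preimage, Set.mem_Icc, Pi.le_def]
    exact forall_and
  rw [h1, (EuclideanSpace.volume_preserving_symm_measurableEquiv_toLp (Fin n)).measure_preimage
    measurableSet_Icc.nullMeasurableSet, Real.volume_Icc_pi]
  simp

lemma ball_bound_aux (u : Euc n → ℝ) (hu0 : ∀ x, 0 ≤ u x) (y : Euc n)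
    (ρ : ℝ) (hρ : 0 < ρ) :
    (volume.withDensity fun x => ENNReal.ofReal (u x)) (Metric.closedBall y ρ) ≤
      ENNReal.ofReal ((2 * ρ) ^ n) * fracMax 0 u y := by
  rw [withDensity_apply _ Metric.isClosed_closedBall.measurableSet]
  set a : Euc n := WithLp.toLp 2 (fun i => y i - ρ) with ha
  have hai : ∀ i, a i = y i - ρ := fun i => rfl
  have hsub : Metric.closedBall y ρ ⊆ Cube a (2 * ρ) := by
    intro x hx i
    have h1 : |x i - y i| ≤ ρ := by
      have := PiLp.norm_apply_le (x - y) i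
      rw [Metric.mem_closedBall, dist_eq_norm] at hx
      simpa using this.trans hx
    rw [abs_le] at h1
    rw [hai]
    constructor <;> linarith
  have hy : y ∈ Cube a (2 * ρ) := hsub (Metric.mem_closedBall_self hρ.le)
  have hV : volume (Cube a (2 * ρ)) = ENNReal.ofReal ((2 * ρ) ^ n) := by
    rw [vol_cube_aux, ENNReal.ofReal_pow (by positivity)]
  have hV0 : ENNReal.ofReal ((2 * ρ) ^ n) ≠ 0 := by
    have : 0 < (2 * ρ) ^ n := by positivity
    simpa using this
  have hM : (volume (Cube a (2 * ρ)))⁻¹ * ∫⁻ x in Cube a (2 * ρ), ENNReal.ofReal (u x)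
      ≤ fracMax 0 u y := by
    unfold fracMax
    refine le_iSup_of_le a (le_iSup_of_le (2 * ρ) (le_iSup_of_le (by positivity)
      (le_iSup_of_le hy (le_of_eq ?_))))
    rw [zero_div, zero_sub, ENNReal.rpow_neg_one]
    simp only [abs_of_nonneg (hu0 _)]
  calc _ ≤ ∫⁻ x in Cube a (2 * ρ), ENNReal.ofReal (u x) := lintegral_mono_set hsub
    _ = ENNReal.ofReal ((2 * ρ) ^ n) * ((volume (Cube a (2 * ρ)))⁻¹ *
          ∫⁻ x in Cube a (2 * ρ), ENNReal.ofReal (u x)) := by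
        rw [hV, ← mul_assoc, ENNReal.mul_inv_cancel hV0 ENNReal.ofReal_ne_top, one_mul]
    _ ≤ _ := by gcongr

/-- The constant of the local part. -/
def nearConst (n : ℕ) (α : ℝ) : ℝ :=
  2 ^ ((n : ℝ) - α) * 2 ^ n * (1 - (2 : ℝ) ^ (-α))⁻¹

lemma near_aux (α : ℝ) (hα : 0 < α) (hαn : α < n) (ν : Measure (Euc n)) (M : ℝ≥0∞) (y : Euc n)
    (hM : ∀ ρ : ℝ, 0 < ρ → ν (Metric.closedBall y ρ) ≤ ENNReal.ofReal ((2 * ρ) ^ n) * M)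
    (r : ℝ) (hr : 0 < r) :
    ∫⁻ x in Metric.closedBall y r, ENNReal.ofReal (‖x - y‖ ^ (α - (n : ℝ))) ∂ν ≤
      ENNReal.ofReal (nearConst n α * r ^ α) * M := by
  set R : ℕ → ℝ := fun k => r * (1 / 2 : ℝ) ^ k with hR
  have hRpos : ∀ k, 0 < R k := fun k => by positivity
  set g : ℕ → Euc n → ℝ≥0∞ := fun k =>
    (Metric.closedBall y (R k)).indicator
      (fun _ => ENNReal.ofReal (R (k + 1) ^ (α - (n : ℝ)))) with hg
  have hpt : ∀ x ∈ Metric.closedBall y r,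
      ENNReal.ofReal (‖x - y‖ ^ (α - (n : ℝ))) ≤ ∑' k, g k x := by
    intro x hx
    rw [Metric.mem_closedBall, dist_eq_norm] at hx
    rcases (norm_nonneg (x - y)).eq_or_lt with h0 | h0
    · rw [← h0, Real.zero_rpow (by linarith)]
      simp
    · obtain ⟨k, hk1, hk2⟩ := exists_nat_pow_near_of_lt_one (x := ‖x - y‖ / r) (y := (1 / 2 : ℝ))
        (by positivity) ((div_le_one hr).2 hx) (by norm_num) (by norm_num)
      rw [lt_div_iff₀ hr, mul_comm] at hk1
      rw [div_le_iff₀ hr, mul_comm] at hk2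
      refine le_trans ?_ (ENNReal.le_tsum k)
      have hmem : x ∈ Metric.closedBall y (R k) := by
        rw [Metric.mem_closedBall, dist_eq_norm]; exact hk2
      simp only [hg, Set.indicator_of_mem hmem]
      exact ENNReal.ofReal_le_ofReal
        (Real.rpow_le_rpow_of_nonpos (hRpos _) hk1.le (by linarith))
  have hterm : ∀ k, R (k + 1) ^ (α - (n : ℝ)) * (2 * R k) ^ n =
      2 ^ ((n : ℝ) - α) * 2 ^ n * r ^ α * ((2 : ℝ) ^ (-α)) ^ k := by
    intro k
    have e1 : R (k + 1) = 2⁻¹ * R k := by simp only [hR]; ring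
    have e2 : R k ^ (α - (n : ℝ)) * R k ^ n = R k ^ α := by
      rw [← Real.rpow_natCast (R k) n, ← Real.rpow_add (hRpos k)]; ring_nf
    have e3 : R k ^ α = r ^ α * ((2 : ℝ) ^ (-α)) ^ k := by
      simp only [hR]
      rw [Real.mul_rpow hr.le (by positivity), ← Real.rpow_natCast, ← Real.rpow_mul (by norm_num),
        ← Real.rpow_natCast, ← Real.rpow_mul (by norm_num), one_div,
        Real.inv_rpow (by norm_num), ← Real.rpow_neg (by norm_num)]
      ring_nf
    have e4 : (2⁻¹ : ℝ) ^ (α - (n : ℝ)) = 2 ^ ((n : ℝ) - α) := by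
      rw [Real.inv_rpow (by norm_num), ← Real.rpow_neg (by norm_num)]; ring_nf
    rw [e1, Real.mul_rpow (by norm_num) (hRpos k).le, mul_pow, e4]
    calc _ = 2 ^ ((n : ℝ) - α) * 2 ^ n * (R k ^ (α - (n : ℝ)) * R k ^ n) := by ring
      _ = _ := by rw [e2, e3]; ring
  have hq0 : (0 : ℝ) ≤ 2 ^ (-α) := by positivity
  have hq1 : (2 : ℝ) ^ (-α) < 1 := Real.rpow_lt_one_of_one_lt_of_neg (by norm_num) (by linarith)
  calc _ ≤ ∫⁻ x in Metric.closedBall y r, ∑' k, g k x ∂ν :=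
        setLIntegral_mono' Metric.isClosed_closedBall.measurableSet hpt
    _ ≤ ∫⁻ x, ∑' k, g k x ∂ν := setLIntegral_le_lintegral _ _
    _ = ∑' k, ∫⁻ x, g k x ∂ν := lintegral_tsum fun k =>
        (measurable_const.indicator Metric.isClosed_closedBall.measurableSet).aemeasurable
    _ = ∑' k, ENNReal.ofReal (R (k + 1) ^ (α - (n : ℝ))) * ν (Metric.closedBall y (R k)) := by
        congr 1; ext k
        simp only [hg]
        rw [lintegral_indicator Metric.isClosed_closedBall.measurableSet, setLIntegral_const]
    _ ≤ ∑' k, ENNReal.ofReal (2 ^ ((n : ℝ) - α) * 2 ^ n * r ^ α * ((2 : ℝ) ^ (-α)) ^ k) * M := by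
        refine ENNReal.tsum_le_tsum fun k => ?_
        rw [← hterm, ENNReal.ofReal_mul (Real.rpow_nonneg (hRpos _).le _), mul_assoc]
        gcongr
        exact hM _ (hRpos k)
    _ = _ := by
        rw [ENNReal.tsum_mul_right, ← ENNReal.ofReal_tsum_of_nonneg (fun k => by positivity)
          ((summable_geometric_of_lt_one hq0 hq1).mul_left _), tsum_mul_left,
          tsum_geometric_of_lt_one hq0 hq1, nearConst]
        congr 2; ring

lemma nearConst_pos (α : ℝ) (hα : 0 < α) : 0 < nearConst n α := by
  have hq1 : (2 : ℝ) ^ (-α) < 1 := Real.rpow_lt_one_of_one_lt_of_neg (by norm_num) (by linarith)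
  have : 0 < (1 - (2 : ℝ) ^ (-α))⁻¹ := inv_pos.2 (by linarith)
  unfold nearConst
  positivity

lemma inner_aux (hn : 0 < n) (α : ℝ) (hα : 0 < α) (hαn : α < n) (ν : Measure (Euc n)) (M : ℝ≥0∞)
    (y : Euc n)
    (hM : ∀ ρ : ℝ, 0 < ρ → ν (Metric.closedBall y ρ) ≤ ENNReal.ofReal ((2 * ρ) ^ n) * M)
    (F : Set (Euc n)) (hF : MeasurableSet F) (hF0 : ν F ≠ 0) (hFt : ν F ≠ ⊤) :
    ∫⁻ x in F, ENNReal.ofReal (‖x - y‖ ^ (α - (n : ℝ))) ∂ν ≤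
      ENNReal.ofReal (nearConst n α + 1) * ν F ^ (α / n) * M ^ ((n - α) / (n : ℝ)) := by
  have hn' : (0 : ℝ) < n := by exact_mod_cast hn
  have hC := nearConst_pos (n := n) α hα
  have hβ : 0 < ((n : ℝ) - α) / n := div_pos (by linarith) hn'
  have hM0 : M ≠ 0 := by
    rintro rfl
    apply hF0
    have : ν (⋃ k : ℕ, Metric.closedBall y k) = 0 := by
      refine measure_iUnion_null fun k => ?_
      have := hM (k + 1) (by positivity)
      rw [mul_zero] at this
      exact measure_mono_null (Metric.closedBall_subset_closedBall (by linarith))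
        (le_antisymm this zero_le)
    rw [Metric.iUnion_closedBall_nat] at this
    exact measure_mono_null (Set.subset_univ F) this
  by_cases hMt : M = ⊤
  · rw [hMt, ENNReal.top_rpow_of_pos hβ, ENNReal.mul_top]
    · exact le_top
    · refine mul_ne_zero (by simpa using by linarith) ?_
      exact (ENNReal.rpow_pos (pos_iff_ne_zero.2 hF0) hFt).ne'
  set a := (ν F).toReal with ha
  set m := M.toReal with hm
  have ha0 : 0 < a := ENNReal.toReal_pos hF0 hFt
  have hm0 : 0 < m := ENNReal.toReal_pos hM0 hMt
  have hae : ν F = ENNReal.ofReal a := (ENNReal.ofReal_toReal hFt).symm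
  have hme : M = ENNReal.ofReal m := (ENNReal.ofReal_toReal hMt).symm
  set r : ℝ := (a / m) ^ (1 / (n : ℝ)) with hr
  have hr0 : 0 < r := by positivity
  have k1 : r ^ α * m = a ^ (α / n) * m ^ (((n : ℝ) - α) / n) := by
    rw [hr, ← Real.rpow_mul (by positivity), Real.div_rpow ha0.le hm0.le,
      show ((n : ℝ) - α) / n = 1 - α / n by field_simp, Real.rpow_sub hm0, Real.rpow_one,
      show 1 / (n : ℝ) * α = α / n by ring]
    ring
  have k2 : r ^ (α - (n : ℝ)) * a = a ^ (α / n) * m ^ (((n : ℝ) - α) / n) := by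
    rw [← k1, Real.rpow_sub hr0]
    have : r ^ (n : ℝ) = a / m := by
      rw [hr, ← Real.rpow_mul (by positivity), one_div, inv_mul_cancel₀ hn'.ne', Real.rpow_one]
    rw [this]
    field_simp
  have hfar : ∫⁻ x in F \ Metric.closedBall y r, ENNReal.ofReal (‖x - y‖ ^ (α - (n : ℝ))) ∂ν ≤
      ENNReal.ofReal (r ^ (α - (n : ℝ))) * ν F := by
    calc _ ≤ ∫⁻ x in F \ Metric.closedBall y r, ENNReal.ofReal (r ^ (α - (n : ℝ))) ∂ν := by
          refine setLIntegral_mono' (hF.diff Metric.isClosed_closedBall.measurableSet) ?_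
          rintro x ⟨-, hx⟩
          rw [Metric.mem_closedBall, dist_eq_norm, not_le] at hx
          exact ENNReal.ofReal_le_ofReal (Real.rpow_le_rpow_of_nonpos hr0 hx.le (by linarith))
      _ = ENNReal.ofReal (r ^ (α - (n : ℝ))) * ν (F \ Metric.closedBall y r) :=
          setLIntegral_const _ _
      _ ≤ _ := by gcongr; exact Set.sdiff_subset
  have hnear := near_aux α hα hαn ν M y hM r hr0
  calc _ ≤ ∫⁻ x in Metric.closedBall y r ∪ F \ Metric.closedBall y r,
            ENNReal.ofReal (‖x - y‖ ^ (α - (n : ℝ))) ∂ν := by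
          refine lintegral_mono_set ?_
          rw [Set.union_sdiff_self]; exact Set.subset_union_right
    _ ≤ _ := lintegral_union_le _ _ _
    _ ≤ _ := add_le_add hnear hfar
    _ = _ := by
      rw [hae, hme, ENNReal.ofReal_rpow_of_pos ha0, ENNReal.ofReal_rpow_of_pos hm0,
        ← ENNReal.ofReal_mul (by positivity), ← ENNReal.ofReal_mul (by positivity),
        ← ENNReal.ofReal_add (by positivity) (by positivity),
        ← ENNReal.ofReal_mul (by positivity), ← ENNReal.ofReal_mul (by positivity),
        mul_assoc, k1, k2]
      congr 1; ring

/-- Fefferman–Stein type weak estimate for the Riesz potential (equation (4.1)):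
`‖I_α f‖_{L^{q₀,∞}(u)} ≤ c ∫ |f| (Mu)^{1/q₀}` with `q₀ = n/(n-α)`, valid for
every weight `u`. -/
theorem riesz_fefferman_stein_weak
    (n : ℕ) (hn : 0 < n) (α : ℝ) (hα : 0 < α) (hαn : α < n) :
    ∃ c : ℝ, 0 < c ∧ ∀ u f : Euc n → ℝ, Measurable u → (∀ x, 0 ≤ u x) → Measurable f →
      weakLpE u (riesz α f) ((n : ℝ) / (n - α)) ≤
        ENNReal.ofReal c *
          ∫⁻ y, ENNReal.ofReal |f y| * fracMax 0 u y ^ ((n - α) / (n : ℝ)) := by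
  have hn' : (0 : ℝ) < n := by exact_mod_cast hn
  have hC := nearConst_pos (n := n) α hα
  have hβ : 0 < ((n : ℝ) - α) / n := div_pos (by linarith) hn'
  refine ⟨nearConst n α + 1, by linarith, fun u f hu hu0 hf => ?_⟩
  set K := ∫⁻ y, ENNReal.ofReal |f y| * fracMax 0 u y ^ ((n - α) / (n : ℝ)) with hK
  set ν := volume.withDensity fun x => ENNReal.ofReal (u x) with hν
  haveI : SigmaFinite ν := SigmaFinite.withDensity_ofReal u
  have hker : Measurable (Function.uncurry fun x y : Euc n =>
      ENNReal.ofReal |f y| * ENNReal.ofReal (‖x - y‖ ^ (α - (n : ℝ)))) := by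
    unfold Function.uncurry
    fun_prop
  have hI : Measurable (riesz α f) := hker.lintegral_prod_right'
  refine iSup₂_le fun t ht => ?_
  set E := {x | ENNReal.ofReal t < riesz α f x} with hE
  have hEm : MeasurableSet E := measurableSet_lt measurable_const hI
  have hw : wMeas u E = ν E := by rw [wMeas, hν, withDensity_apply _ hEm]
  have ht0 : ENNReal.ofReal t ≠ 0 := by simpa using ht
  rw [hw, one_div_div]
  -- the estimate for subsets of finite measure
  have key : ∀ F : Set (Euc n), MeasurableSet F → F ⊆ E → ν F ≠ 0 → ν F ≠ ⊤ →
      ENNReal.ofReal t * ν F ^ (((n : ℝ) - α) / n) ≤ ENNReal.ofReal (nearConst n α + 1) * K := by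
    intro F hF hFE hF0 hFt
    have hA0 : ν F ^ (α / n) ≠ 0 := (ENNReal.rpow_pos (pos_iff_ne_zero.2 hF0) hFt).ne'
    have hAt : ν F ^ (α / n) ≠ ⊤ := ENNReal.rpow_ne_top_of_nonneg (by positivity) hFt
    have h1 : ENNReal.ofReal t * ν F ≤
        ν F ^ (α / n) * (ENNReal.ofReal (nearConst n α + 1) * K) := by
      calc ENNReal.ofReal t * ν F = ∫⁻ x in F, ENNReal.ofReal t ∂ν := (setLIntegral_const _ _).symm
        _ ≤ ∫⁻ x in F, riesz α f x ∂ν := setLIntegral_mono' hF fun x hx => (hFE hx).le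
        _ = ∫⁻ y, ∫⁻ x in F, ENNReal.ofReal |f y| *
              ENNReal.ofReal (‖x - y‖ ^ (α - (n : ℝ))) ∂ν :=
            lintegral_lintegral_swap hker.aemeasurable
        _ ≤ ∫⁻ y, (ENNReal.ofReal (nearConst n α + 1) * ν F ^ (α / n)) *
              (ENNReal.ofReal |f y| * fracMax 0 u y ^ ((n - α) / (n : ℝ))) := by
            refine lintegral_mono fun y => ?_
            rw [lintegral_const_mul' _ _ ENNReal.ofReal_ne_top, mul_left_comm]
            gcongr
            exact inner_aux hn α hα hαn ν _ y (fun ρ hρ => ball_bound_aux u hu0 y ρ hρ) F hF hF0 hFt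
        _ = _ := by
            rw [lintegral_const_mul' _ _ (ENNReal.mul_ne_top ENNReal.ofReal_ne_top hAt), ← hK]
            ring
    have h2 : ν F = ν F ^ (α / n) * ν F ^ (((n : ℝ) - α) / n) := by
      rw [← ENNReal.rpow_add _ _ hF0 hFt, show α / n + ((n : ℝ) - α) / n = 1 by field_simp; ring,
        ENNReal.rpow_one]
    rw [h2, mul_left_comm, ← h2] at h1
    exact (ENNReal.mul_le_mul_iff_right hA0 hAt).1 h1
  rw [mul_comm, ← ENNReal.le_div_iff_mul_le (Or.inl ht0) (Or.inl ENNReal.ofReal_ne_top),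
    ← ENNReal.le_rpow_inv_iff hβ]
  refine le_of_forall_lt fun s hs => ?_
  obtain ⟨F, hF, hFE, hsF, hFt⟩ := Measure.exists_subset_measure_lt_top hEm hs
  refine hsF.trans_le ?_
  have := key F hF hFE (ne_bot_of_gt hsF) hFt.ne
  rwa [mul_comm, ← ENNReal.le_div_iff_mul_le (Or.inl ht0) (Or.inl ENNReal.ofReal_ne_top),
    ← ENNReal.le_rpow_inv_iff hβ] at this

end
end

section
/- Power-weight lower bound witnessing sharpness: Let 0 < α < n, 1 < p < n/α, define q by 1/q = 1/p − α/n, and for 0 < δ < 1 set w_δ(x) = |x|^{(n−δ)/p′} and f_δ(x) = |x|^{δ−n}·χ_B(x), where B is the unit ball of ℝⁿ. Then there are constants C₁, C₂, C₃, c₄ > 0 depending only on n, α, p such that for all 0 < δ < 1: (i) [w_δ]_{A_{p,q}} ≤ C₁ δ^{−q/p′}; (ii) C₂^{-1} δ^{−1/p} ≤ ‖w_δ f_δ‖_{L^p(ℝⁿ)} ≤ C₂ δ^{−1/p}; (iii) ‖w_δ · M_α f_δ‖_{L^q(ℝⁿ)} ≥ c₄ δ^{−1−1/q}; and consequently (by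 M_α ≤ C·I_α pointwise on non-negative functions) ‖w_δ · I_α f_δ‖_{L^q(ℝⁿ)} ≥ c₄′ δ^{−1−1/q}. -/
open MeasureTheory ENNReal Set

noncomputable section

variable {n : ℕ}

/-- The power weight `w_δ(x) = |x|^{(n-δ)/p'}`. -/
def powerWeight (n : ℕ) (p δ : ℝ) : Euc n → ℝ :=
  fun x => ‖x‖ ^ ((n - δ) / dualExp p)

/-- The test function `f_δ(x) = |x|^{δ-n} χ_B(x)`, `B` the unit ball. -/
def powerTest (n : ℕ) (δ : ℝ) : Euc n → ℝ :=
  fun x => if ‖x‖ < 1 then ‖x‖ ^ (δ - (n : ℝ)) else 0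

/-- The surface constant. -/
def surfK (n : ℕ) : ℝ := n * (volume : Measure (Euc n)).real (Metric.ball 0 1)

lemma surfK_pos (hn : 0 < n) : 0 < surfK n := by
  have h1 : 0 < (volume : Measure (Euc n)).real (Metric.ball 0 1) := by
    rw [Measure.real]
    exact ENNReal.toReal_pos (Metric.measure_ball_pos _ _ one_pos).ne' measure_ball_lt_top.ne
  have : (0:ℝ) < n := by exact_mod_cast hn
  exact mul_pos this h1

lemma ball_int (hn : 0 < n) (s R : ℝ) (hs : 0 < s) (hR : 0 < R) :
    ∫⁻ x in Metric.ball (0 : Euc n) R, ENNReal.ofReal (‖x‖ ^ (s - n)) =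
      ENNReal.ofReal (surfK n * R ^ s / s) := by
  have : Nonempty (Fin n) := ⟨⟨0, hn⟩⟩
  have : Nontrivial (Euc n) := inferInstance
  have hdim : Module.finrank ℝ (Euc n) = n := by simp
  have key : ∀ y : ℝ, 0 < y → y ^ (n - 1) * y ^ (s - n) = y ^ (s - 1) := by
    intro y hy
    rw [← Real.rpow_natCast, ← Real.rpow_add hy]
    congr 1
    rw [Nat.cast_sub hn]; push_cast; ring
  have hint : IntegrableOn (fun x : Euc n => ‖x‖ ^ (s - n)) (Metric.ball (0 : Euc n) R) := by
    rw [integrableOn_fun_norm_addHaar (volume : Measure (Euc n)) (f := fun y => y ^ (s - n)), hdim]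
    have : IntegrableOn (fun y : ℝ => y ^ (s - 1)) (Ioo 0 R) := by
      rw [intervalIntegral.integrableOn_Ioo_rpow_iff hR]; linarith
    refine this.congr_fun ?_ measurableSet_Ioo
    intro y hy
    simp only [smul_eq_mul]
    exact (key y hy.1).symm
  rw [← ofReal_integral_eq_lintegral_ofReal hint
    (Filter.Eventually.of_forall fun x => Real.rpow_nonneg (norm_nonneg x) _)]
  congr 1
  have e1 : ∫ x in Metric.ball (0 : Euc n) R, ‖x‖ ^ (s - n) =
      ∫ x : Euc n, (Iio R).indicator (fun y : ℝ => y ^ (s - n)) ‖x‖ := by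
    rw [← integral_indicator measurableSet_ball]
    congr 1
    ext x
    simp [indicator]
  rw [e1, integral_fun_norm_addHaar, hdim]
  have e2 : ∫ y in Ioi (0:ℝ), y ^ (n - 1) • (Iio R).indicator (fun y : ℝ => y ^ (s - n)) y =
      ∫ y in Ioo (0:ℝ) R, y ^ (s - 1) := by
    rw [← integral_indicator measurableSet_Ioi, ← integral_indicator measurableSet_Ioo]
    congr 1
    ext y
    by_cases h0 : 0 < y <;> by_cases h1 : y < R <;> simp [indicator, h0, h1, key]
  rw [e2, ← integral_Ioc_eq_integral_Ioo, ← intervalIntegral.integral_of_le hR.le,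
    integral_rpow (Or.inl (by linarith))]
  simp [surfK, Real.zero_rpow hs.ne']
  ring

lemma vol_cube (a : Euc n) (h : ℝ) (hh : 0 < h) :
    volume (Cube a h) = ENNReal.ofReal (h ^ n) := by
  have : Cube a h = (MeasurableEquiv.toLp 2 (Fin n → ℝ)).symm ⁻¹'
      (Icc (fun i => a i) (fun i => a i + h)) := by
    ext x
    simp [Cube, Pi.le_def, forall_and]
  rw [this, (EuclideanSpace.volume_preserving_symm_measurableEquiv_toLp (Fin n)).measure_preimage
    measurableSet_Icc.nullMeasurableSet, Real.volume_Icc_pi]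
  simp [ENNReal.ofReal_pow hh.le]

lemma meas_cube (a : Euc n) (h : ℝ) : MeasurableSet (Cube a h) := by
  have : Cube a h = (MeasurableEquiv.toLp 2 (Fin n → ℝ)).symm ⁻¹'
      (Icc (fun i => a i) (fun i => a i + h)) := by
    ext x
    simp [Cube, Pi.le_def, forall_and]
  rw [this]
  exact (MeasurableEquiv.measurable _) measurableSet_Icc

lemma cube_dist (a x : Euc n) (h : ℝ) (hh : 0 < h) (hx : x ∈ Cube a h) :
    ‖x - a‖ ≤ √n * h := by
  rw [EuclideanSpace.norm_eq]
  refine Real.sqrt_le_iff.2 ⟨by positivity, ?_⟩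
  have : ∀ i ∈ Finset.univ, ‖(x - a) i‖ ^ 2 ≤ h ^ 2 := by
    intro i _
    have := hx i
    refine pow_le_pow_left₀ (norm_nonneg _) ?_ 2
    rw [PiLp.sub_apply, Real.norm_eq_abs, abs_le]
    constructor <;> linarith
  calc _ ≤ ∑ i : Fin n, h ^ 2 := Finset.sum_le_sum this
    _ = _ := by simp [mul_pow]

lemma avg_le (a : Euc n) (h : ℝ) (hh : 0 < h) (f : Euc n → ℝ≥0∞) (c : ℝ≥0∞)
    (hf : ∀ x ∈ Cube a h, f x ≤ c) :
    (volume (Cube a h))⁻¹ * ∫⁻ x in Cube a h, f x ≤ c := by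
  have h0 : volume (Cube a h) ≠ 0 := by
    rw [vol_cube a h hh]; simpa using pow_pos hh n
  have h1 : volume (Cube a h) ≠ ⊤ := by
    rw [vol_cube a h hh]; simp
  calc _ ≤ (volume (Cube a h))⁻¹ * (c * volume (Cube a h)) := by
        gcongr
        calc _ ≤ ∫⁻ x in Cube a h, c := setLIntegral_mono' (meas_cube a h) hf
          _ = _ := by simp
    _ = c := by
        rw [mul_comm c, ← mul_assoc, ENNReal.inv_mul_cancel h0 h1, one_mul]

lemma ae_ne_zero (hn : 0 < n) : ∀ᵐ x : Euc n, x ≠ 0 := by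
  have : Nonempty (Fin n) := ⟨⟨0, hn⟩⟩
  have : Nontrivial (Euc n) := inferInstance
  exact Measure.ae_ne volume 0

lemma dualExp_pos {p : ℝ} (hp : 1 < p) : 0 < dualExp p :=
  div_pos (by linarith) (by linarith)

lemma part_i (hn : 0 < n) (p q δ : ℝ) (hp : 1 < p) (hq : 0 < q) (hδ : 0 < δ) (hδ1 : δ < 1) :
    Apq p q (powerWeight n p δ) ≤ ENNReal.ofReal
      (((surfK n * (4 * √n) ^ n) ^ (q / dualExp p) + ((4:ℝ) ^ n) ^ (q / dualExp p))
        * δ ^ (-(q / dualExp p))) := by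
  have hp' := dualExp_pos hp
  set p' := dualExp p with hp'def
  have hn1 : (1:ℝ) ≤ n := by exact_mod_cast hn
  have hK := surfK_pos hn
  have hD : 0 < √(n:ℝ) := Real.sqrt_pos.2 (by linarith)
  have hnδ : 0 < n - δ := by linarith
  have hθ : 0 < q / p' := div_pos hq hp'
  set θ := q / p' with hθdef
  have hβ : (n - δ) / p' * q = (n - δ) * θ := by rw [hθdef]; ring
  have hδθ : δ ^ (-θ) = (δ ^ θ)⁻¹ := Real.rpow_neg hδ.le _
  have hw1 : ∀ x : Euc n, ENNReal.ofReal (powerWeight n p δ x) ^ q =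
      ENNReal.ofReal (‖x‖ ^ ((n - δ) * θ)) := by
    intro x
    rw [powerWeight, ENNReal.ofReal_rpow_of_nonneg (by positivity) hq.le,
      ← Real.rpow_mul (norm_nonneg x), hβ]
  have hw2 : ∀ x : Euc n, x ≠ 0 → ENNReal.ofReal (powerWeight n p δ x) ^ (-p') =
      ENNReal.ofReal (‖x‖ ^ (δ - n)) := by
    intro x hx
    have hx' := norm_pos_iff.2 hx
    rw [powerWeight, ENNReal.ofReal_rpow_of_pos (by positivity),
      ← Real.rpow_mul (norm_nonneg x), ← hp'def]
    congr 2
    field_simp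
    ring
  unfold Apq
  refine iSup_le fun a => iSup_le fun h => iSup_le fun hh => ?_
  rw [if_neg hp.ne', ← hp'def, ← hθdef, add_mul]
  have hdist : ∀ x ∈ Cube a h, ‖x - a‖ ≤ √n * h := fun x hx => cube_dist a x h hh hx
  rcases le_or_gt ‖a‖ (2 * √n * h) with hc | hc
  · set R := 4 * √n * h with hR
    have hRpos : 0 < R := by positivity
    have hsub : Cube a h ⊆ Metric.ball 0 R := by
      intro x hx
      have h1 := hdist x hx
      have h2 : ‖x‖ ≤ ‖x - a‖ + ‖a‖ := by simpa using norm_add_le (x - a) a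
      have : 0 < √n * h := by positivity
      rw [mem_ball_zero_iff]
      nlinarith
    have A1 : (volume (Cube a h))⁻¹ * ∫⁻ x in Cube a h, ENNReal.ofReal (powerWeight n p δ x) ^ q
        ≤ ENNReal.ofReal (R ^ ((n - δ) * θ)) := by
      refine avg_le a h hh _ _ fun x hx => ?_
      rw [hw1]
      have := mem_ball_zero_iff.1 (hsub hx)
      gcongr
    have A2 : (volume (Cube a h))⁻¹ * ∫⁻ x in Cube a h, ENNReal.ofReal (powerWeight n p δ x) ^ (-p')
        ≤ ENNReal.ofReal (surfK n * R ^ δ / δ / h ^ n) := by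
      rw [vol_cube a h hh, ← ENNReal.ofReal_inv_of_pos (by positivity), div_eq_inv_mul _ (h ^ n),
        ENNReal.ofReal_mul (by positivity)]
      gcongr
      rw [← ball_int hn δ R hδ hRpos]
      calc _ ≤ ∫⁻ x in Metric.ball 0 R, ENNReal.ofReal (powerWeight n p δ x) ^ (-p') :=
            lintegral_mono_set hsub
        _ = _ := by
            apply lintegral_congr_ae
            filter_upwards [ae_restrict_of_ae (ae_ne_zero hn)] with x hx
            exact hw2 x hx
    calc _ ≤ ENNReal.ofReal (R ^ ((n - δ) * θ)) *
          ENNReal.ofReal (surfK n * R ^ δ / δ / h ^ n) ^ θ := by gcongr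
      _ = ENNReal.ofReal ((surfK n * (4 * √n) ^ n) ^ θ * δ ^ (-θ)) := by
          rw [ENNReal.ofReal_rpow_of_nonneg (by positivity) hθ.le,
            ← ENNReal.ofReal_mul (by positivity), Real.rpow_mul hRpos.le,
            ← Real.mul_rpow (by positivity) (by positivity), hδθ, ← Real.inv_rpow hδ.le,
            ← Real.mul_rpow (by positivity) (by positivity)]
          congr 2
          rw [Real.rpow_sub hRpos, Real.rpow_natCast]
          have : R ^ δ ≠ 0 := by positivity
          field_simp
          rw [hR]; ring
      _ ≤ _ := by
          apply ENNReal.ofReal_le_ofReal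
          have : 0 ≤ ((4:ℝ) ^ n) ^ θ * δ ^ (-θ) := by positivity
          linarith
  · have hDh : 0 < √n * h := by positivity
    have hapos : 0 < ‖a‖ := by nlinarith
    have hlow : ∀ x ∈ Cube a h, ‖a‖ / 2 ≤ ‖x‖ := by
      intro x hx
      have h1 := hdist x hx
      have h2 : ‖a‖ ≤ ‖x - a‖ + ‖x‖ := by
        have := norm_sub_norm_le a x
        rw [norm_sub_rev] at this; linarith
      nlinarith
    have hupp : ∀ x ∈ Cube a h, ‖x‖ ≤ 4 * (‖a‖ / 2) := by
      intro x hx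
      have h1 := hdist x hx
      have h2 : ‖x‖ ≤ ‖x - a‖ + ‖a‖ := by simpa using norm_add_le (x - a) a
      nlinarith
    set m := ‖a‖ / 2 with hm
    have hmpos : 0 < m := by positivity
    have A1 : (volume (Cube a h))⁻¹ * ∫⁻ x in Cube a h, ENNReal.ofReal (powerWeight n p δ x) ^ q
        ≤ ENNReal.ofReal ((4 * m) ^ ((n - δ) * θ)) := by
      refine avg_le a h hh _ _ fun x hx => ?_
      rw [hw1]
      have := hupp x hx
      gcongr
    have A2 : (volume (Cube a h))⁻¹ * ∫⁻ x in Cube a h, ENNReal.ofReal (powerWeight n p δ x) ^ (-p')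
        ≤ ENNReal.ofReal (m ^ (δ - n)) := by
      refine avg_le a h hh _ _ fun x hx => ?_
      have := hlow x hx
      rw [hw2 x (norm_pos_iff.1 (by linarith))]
      apply ENNReal.ofReal_le_ofReal
      exact Real.rpow_le_rpow_of_nonpos hmpos this (by linarith)
    calc _ ≤ ENNReal.ofReal ((4 * m) ^ ((n - δ) * θ)) * ENNReal.ofReal (m ^ (δ - n)) ^ θ := by
          gcongr
      _ = ENNReal.ofReal ((4 ^ (n - δ)) ^ θ) := by
          rw [ENNReal.ofReal_rpow_of_nonneg (by positivity) hθ.le,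
            ← ENNReal.ofReal_mul (by positivity), Real.rpow_mul (by positivity),
            ← Real.mul_rpow (by positivity) (by positivity)]
          congr 2
          rw [Real.mul_rpow (by norm_num) hmpos.le, mul_assoc, ← Real.rpow_add hmpos]
          simp
      _ ≤ _ := by
          apply ENNReal.ofReal_le_ofReal
          have h1 : (4:ℝ) ^ (n - δ) ≤ 4 ^ n := by
            rw [← Real.rpow_natCast]
            exact Real.rpow_le_rpow_of_exponent_le (by norm_num) (by linarith)
          have h2 : ((4:ℝ) ^ (n - δ)) ^ θ ≤ ((4:ℝ) ^ n) ^ θ := by gcongr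
          have h3 : 1 ≤ δ ^ (-θ) :=
            Real.one_le_rpow_of_pos_of_le_one_of_nonpos hδ hδ1.le (by linarith)
          have h4 : 0 ≤ (surfK n * (4 * √n) ^ n) ^ θ * δ ^ (-θ) := by positivity
          have h5 : 0 ≤ ((4:ℝ) ^ n) ^ θ := by positivity
          nlinarith

lemma part_ii (hn : 0 < n) (p δ : ℝ) (hp : 1 < p) (hδ : 0 < δ) :
    wLp (powerWeight n p δ) (powerTest n δ) p =
      ENNReal.ofReal (surfK n ^ (1 / p) * δ ^ (-(1 / p))) := by
  have hp' := dualExp_pos hp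
  have hK := surfK_pos hn
  have hp0 : 0 < p := by linarith
  unfold wLp
  have e : ∫⁻ x, (ENNReal.ofReal (powerWeight n p δ x) * ENNReal.ofReal |powerTest n δ x|) ^ p =
      ∫⁻ x in Metric.ball (0 : Euc n) 1, ENNReal.ofReal (‖x‖ ^ (δ - n)) := by
    rw [← lintegral_indicator measurableSet_ball]
    apply lintegral_congr_ae
    filter_upwards [ae_ne_zero hn] with x hx
    have hx' := norm_pos_iff.2 hx
    by_cases h1 : ‖x‖ < 1
    · rw [indicator_of_mem (by simpa using h1), powerTest, if_pos h1, powerWeight,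
        abs_of_nonneg (by positivity), ← ENNReal.ofReal_mul (by positivity),
        ENNReal.ofReal_rpow_of_nonneg (by positivity) hp0.le, ← Real.rpow_add hx',
        ← Real.rpow_mul hx'.le]
      congr 2
      rw [dualExp]
      have : p - 1 ≠ 0 := by linarith
      field_simp
      ring
    · rw [indicator_of_notMem (by simpa using h1), powerTest, if_neg h1]
      simp [hp0]
  rw [e, ball_int hn δ 1 hδ one_pos, ENNReal.ofReal_rpow_of_nonneg (by positivity) (by positivity)]
  congr 1
  rw [Real.one_rpow, mul_one, Real.div_rpow hK.le hδ.le, Real.rpow_neg hδ.le, div_eq_mul_inv]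

lemma part_low (hn : 0 < n) (α p q δ c : ℝ) (hc : 0 < c) (hp : 1 < p) (hq0 : 0 < q)
    (hq : 1 / q = 1 / p - α / n) (hδ : 0 < δ) (g : Euc n → ℝ≥0∞)
    (hg : ∀ x, 0 < ‖x‖ → ‖x‖ < 1 → ENNReal.ofReal (c * ‖x‖ ^ (α - n + δ) / δ) ≤ g x) :
    ENNReal.ofReal (c * (surfK n * p / q) ^ (1 / q) * δ ^ (-(1 + 1 / q))) ≤
      wLpE (powerWeight n p δ) g q := by
  have hp' := dualExp_pos hp
  have hK := surfK_pos hn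
  have hp0 : 0 < p := by linarith
  have hn0 : (0:ℝ) < n := by exact_mod_cast hn
  unfold wLpE
  have hexp : ((n - δ) / dualExp p + (α - n + δ)) * q = δ * q / p - n := by
    have hα : α = n * (1 / p - 1 / q) := by rw [hq]; field_simp; ring
    have : p - 1 ≠ 0 := by linarith
    rw [hα, dualExp]
    field_simp
    ring
  have e : ENNReal.ofReal ((c / δ) ^ q * (surfK n * 1 ^ (δ * q / p) / (δ * q / p))) ≤
      ∫⁻ x, (ENNReal.ofReal (powerWeight n p δ x) * g x) ^ q := by
    rw [ENNReal.ofReal_mul (by positivity), ← ball_int hn _ 1 (by positivity) one_pos,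
      ← lintegral_const_mul' _ _ ENNReal.ofReal_ne_top, ← lintegral_indicator measurableSet_ball]
    apply lintegral_mono_ae
    filter_upwards [ae_ne_zero hn] with x hx
    have hx' := norm_pos_iff.2 hx
    by_cases h1 : ‖x‖ < 1
    · rw [indicator_of_mem (by simpa using h1)]
      calc _ = (ENNReal.ofReal (powerWeight n p δ x) *
            ENNReal.ofReal (c * ‖x‖ ^ (α - n + δ) / δ)) ^ q := by
            rw [powerWeight, ← ENNReal.ofReal_mul (by positivity), ← ENNReal.ofReal_mul (by positivity),
              ENNReal.ofReal_rpow_of_nonneg (by positivity) hq0.le, ← hexp, Real.rpow_mul hx'.le,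
              ← Real.mul_rpow (by positivity) (by positivity), Real.rpow_add hx']
            congr 2
            ring
        _ ≤ _ := by
            have := hg x hx' h1
            gcongr
    · rw [indicator_of_notMem (by simpa using h1)]
      exact zero_le
  calc _ = ENNReal.ofReal ((c / δ) ^ q * (surfK n * 1 ^ (δ * q / p) / (δ * q / p))) ^ (1 / q) := by
        rw [ENNReal.ofReal_rpow_of_nonneg (by positivity) (by positivity)]
        congr 1
        rw [Real.mul_rpow (by positivity) (by positivity), ← Real.rpow_mul (by positivity),
          mul_one_div_cancel hq0.ne', Real.rpow_one, Real.one_rpow,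
          show surfK n * 1 / (δ * q / p) = (surfK n * p / q) / δ by field_simp,
          Real.div_rpow (by positivity) hδ.le, Real.rpow_neg hδ.le, Real.rpow_add hδ, Real.rpow_one]
        field_simp
    _ ≤ _ := by gcongr

lemma test_ball (hn : 0 < n) (δ r : ℝ) (hδ : 0 < δ) (hr : 0 < r) (hr1 : r < 1) :
    ∫⁻ y in Metric.ball (0 : Euc n) r, ENNReal.ofReal |powerTest n δ y| =
      ENNReal.ofReal (surfK n * r ^ δ / δ) := by
  rw [← ball_int hn δ r hδ hr]
  apply setLIntegral_congr_fun measurableSet_ball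
  intro y hy
  have : ‖y‖ < r := by simpa using hy
  simp only
  rw [powerTest, if_pos (by linarith), abs_of_nonneg (by positivity)]

lemma fracMax_low (hn : 0 < n) (α δ : ℝ) (hδ : 0 < δ) (x : Euc n) (hx : 0 < ‖x‖) (hx1 : ‖x‖ < 1) :
    ENNReal.ofReal ((2 ^ (α - n) * surfK n) * ‖x‖ ^ (α - n + δ) / δ) ≤
      fracMax α (powerTest n δ) x := by
  have hK := surfK_pos hn
  have hn0 : (0:ℝ) < n := by exact_mod_cast hn
  have hcoord : ∀ y : Euc n, ∀ i, |y i| ≤ ‖y‖ := fun y i => by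
    simpa using PiLp.norm_apply_le y i
  have hmem : ∀ y : Euc n, ‖y‖ ≤ ‖x‖ → y ∈ Cube (WithLp.toLp 2 fun _ => -‖x‖ : Euc n) (2 * ‖x‖) := by
    intro y hy i
    have := abs_le.1 ((hcoord y i).trans hy)
    simp only
    constructor <;> linarith
  unfold fracMax
  refine le_trans ?_ (le_iSup_of_le (WithLp.toLp 2 fun _ => -‖x‖ : Euc n) <|
    le_iSup_of_le (2 * ‖x‖) <| le_iSup_of_le (by positivity) <|
    le_iSup_of_le (hmem x le_rfl) le_rfl)
  rw [vol_cube _ _ (by positivity)]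
  calc _ = ENNReal.ofReal ((2 * ‖x‖) ^ n) ^ (α / n - 1) *
        ∫⁻ y in Metric.ball (0 : Euc n) ‖x‖, ENNReal.ofReal |powerTest n δ y| := by
        rw [test_ball hn δ _ hδ hx hx1, ENNReal.ofReal_rpow_of_pos (by positivity),
          ← ENNReal.ofReal_mul (by positivity), ← Real.rpow_natCast,
          ← Real.rpow_mul (by positivity), show (n:ℝ) * (α / n - 1) = α - n by field_simp,
          Real.mul_rpow (by norm_num) hx.le, Real.rpow_add hx]
        congr 1
        ring
    _ ≤ _ := by
        gcongr
        intro y hy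
        exact hmem y (mem_ball_zero_iff.1 hy).le

lemma riesz_low (hn : 0 < n) (α δ : ℝ) (hαn : α < n) (hδ : 0 < δ) (x : Euc n)
    (hx : 0 < ‖x‖) (hx1 : ‖x‖ < 1) :
    ENNReal.ofReal ((2 ^ (α - n) * surfK n) * ‖x‖ ^ (α - n + δ) / δ) ≤
      riesz α (powerTest n δ) x := by
  have hK := surfK_pos hn
  unfold riesz
  calc _ = (∫⁻ y in Metric.ball (0 : Euc n) ‖x‖, ENNReal.ofReal |powerTest n δ y|) *
        ENNReal.ofReal ((2 * ‖x‖) ^ (α - n)) := by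
        rw [test_ball hn δ _ hδ hx hx1, ← ENNReal.ofReal_mul (by positivity),
          Real.mul_rpow (by norm_num) hx.le, Real.rpow_add hx]
        congr 1
        ring
    _ = ∫⁻ y in Metric.ball (0 : Euc n) ‖x‖, ENNReal.ofReal |powerTest n δ y| *
        ENNReal.ofReal ((2 * ‖x‖) ^ (α - n)) := (lintegral_mul_const' _ _ ENNReal.ofReal_ne_top).symm
    _ ≤ ∫⁻ y in Metric.ball (0 : Euc n) ‖x‖, ENNReal.ofReal |powerTest n δ y| *
        ENNReal.ofReal (‖x - y‖ ^ (α - n)) := by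
        refine setLIntegral_mono' measurableSet_ball fun y hy => ?_
        have hy' : ‖y‖ < ‖x‖ := by simpa using hy
        have h1 : 0 < ‖x - y‖ := by
          have := norm_sub_norm_le x y
          linarith
        have h2 : ‖x - y‖ ≤ 2 * ‖x‖ := by
          have := norm_sub_le x y
          linarith
        have := Real.rpow_le_rpow_of_nonpos h1 h2 (show α - n ≤ 0 by linarith)
        gcongr
    _ ≤ _ := setLIntegral_le_lintegral _ _

/-- Power-weight lower bounds witnessing sharpness (Section 6): behaviour, as
`δ → 0⁺`, of the `A_{p,q}` constant of `w_δ`, of `‖w_δ f_δ‖_{L^p}`, and of the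
weighted `L^q` norms of `M_α f_δ` and `I_α f_δ`. -/
theorem power_weight_sharpness_example
    (n : ℕ) (hn : 0 < n) (α p q : ℝ) (hα : 0 < α) (hαn : α < n)
    (hp : 1 < p) (hpn : p < n / α) (hq : 1 / q = 1 / p - α / n) :
    ∃ C₁ C₂ c₄ c₄' : ℝ, 0 < C₁ ∧ 0 < C₂ ∧ 0 < c₄ ∧ 0 < c₄' ∧
      ∀ δ : ℝ, 0 < δ → δ < 1 →
        Apq p q (powerWeight n p δ) ≤ ENNReal.ofReal (C₁ * δ ^ (-(q / dualExp p))) ∧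
        ENNReal.ofReal (C₂⁻¹ * δ ^ (-(1 / p))) ≤ wLp (powerWeight n p δ) (powerTest n δ) p ∧
        wLp (powerWeight n p δ) (powerTest n δ) p ≤ ENNReal.ofReal (C₂ * δ ^ (-(1 / p))) ∧
        ENNReal.ofReal (c₄ * δ ^ (-(1 + 1 / q))) ≤
          wLpE (powerWeight n p δ) (fracMax α (powerTest n δ)) q ∧
        ENNReal.ofReal (c₄' * δ ^ (-(1 + 1 / q))) ≤
          wLpE (powerWeight n p δ) (riesz α (powerTest n δ)) q := by
  have hn0 : (0:ℝ) < n := by exact_mod_cast hn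
  have hp0 : 0 < p := by linarith
  have hq0 : 0 < q := by
    have h1 : p * α < n := (lt_div_iff₀ hα).1 hpn
    have : 0 < 1 / q := by
      rw [hq, sub_pos, div_lt_div_iff₀ hn0 hp0]
      linarith
    exact one_div_pos.1 this
  have hK := surfK_pos hn
  have hD : 0 < √(n:ℝ) := Real.sqrt_pos.2 hn0
  have hS : 0 < surfK n ^ (1 / p) := by positivity
  have hc : 0 < (2:ℝ) ^ (α - n) * surfK n := by positivity
  refine ⟨(surfK n * (4 * √n) ^ n) ^ (q / dualExp p) + ((4:ℝ) ^ n) ^ (q / dualExp p),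
    surfK n ^ (1 / p) + (surfK n ^ (1 / p))⁻¹,
    2 ^ (α - n) * surfK n * (surfK n * p / q) ^ (1 / q),
    2 ^ (α - n) * surfK n * (surfK n * p / q) ^ (1 / q),
    by positivity, by positivity, by positivity, by positivity, ?_⟩
  intro δ hδ hδ1
  refine ⟨part_i hn p q δ hp hq0 hδ hδ1, ?_, ?_, ?_, ?_⟩
  · rw [part_ii hn p δ hp hδ]
    apply ENNReal.ofReal_le_ofReal
    gcongr
    rw [inv_le_comm₀ (by positivity) hS]
    linarith
  · rw [part_ii hn p δ hp hδ]
    apply ENNReal.ofReal_le_ofReal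
    gcongr
    have := inv_pos.2 hS
    linarith
  · exact part_low hn α p q δ _ hc hp hq0 hq hδ _ fun x hx hx1 => fracMax_low hn α δ hδ x hx hx1
  · exact part_low hn α p q δ _ hc hp hq0 hq hδ _ fun x hx hx1 => riesz_low hn α δ hαn hδ x hx hx1

end
end
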